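/- Let σ be a conductance matrix on n ≥ 2 nodes and fix a pair of distinct nodes k, l. For t ≥ 0 let σ_t be the conductance matrix agreeing with σ except that the (k,l) and (l,k) entries are set to t. Then there exist constants A, B, C, D ≥ 0, depending only on the entries of σ outside positions (k,l) and (l,k), such that for all t ≥ 0: det Σ'(σ_t) = A·t + B and det Σ''(σ_t) = C·t + D. In particular, the equivalent conductance is a Möbius (linear-fractional) function (A·t + B)/(C·t + D) of any single edge conductance t. -/

import Mathlib

open Matrix BigOperators

/-- A conductance matrix: symmetric, nonnegative entries, zero diagonal. -/
def IsConductance {N : ℕ} (σ : Matrix (Fin N) (Fin N) ℝ) : Prop :=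
  (∀ i j, σ i j = σ j i) ∧ (∀ i j, 0 ≤ σ i j) ∧ (∀ i, σ i i = 0)

/-- The weighted Laplacian of a conductance matrix. -/
def lap {N : ℕ} (σ : Matrix (Fin N) (Fin N) ℝ) : Matrix (Fin N) (Fin N) ℝ :=
  Matrix.of fun i j => if i = j then ∑ k, σ i k else -σ i j

/-- Σ'(σ): the Laplacian with the row and column of the last node deleted. -/
def sigmaP {n : ℕ} (σ : Matrix (Fin (n+2)) (Fin (n+2)) ℝ) :
    Matrix (Fin (n+1)) (Fin (n+1)) ℝ :=
  (lap σ).submatrix Fin.castSucc Fin.castSucc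

/-- Σ''(σ): the Laplacian with the rows and columns of the first and last nodes deleted. -/
def sigmaPP {n : ℕ} (σ : Matrix (Fin (n+2)) (Fin (n+2)) ℝ) :
    Matrix (Fin n) (Fin n) ℝ :=
  (lap σ).submatrix (fun i => i.succ.castSucc) (fun i => i.succ.castSucc)

/-- The junction rules: total current out of each interior node vanishes. -/
def Junction {n : ℕ} (σ : Matrix (Fin (n+2)) (Fin (n+2)) ℝ) (V : Fin (n+2) → ℝ) : Prop :=
  ∀ i : Fin (n+2), i ≠ 0 → i ≠ Fin.last (n+1) → ∑ j, σ i j * (V i - V j) = 0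

/-- The determinant of a rank-one perturbation `M + t • u vᵀ` is an affine function of `t`. -/
theorem det_add_smul_vecMulVec {m R : Type*} [Fintype m] [DecidableEq m] [CommRing R]
    (M : Matrix m m R) (u v : m → R) (t : R) :
    (M + t • vecMulVec u v).det =
      (fromBlocks M (replicateCol Unit u) (-replicateRow Unit v) 0).det * t + M.det := by
  have bordered (c : R) (d : R) :
      fromBlocks M (replicateCol Unit u) (-(c • replicateRow Unit v)) (d • 1) =
        (fromBlocks M (replicateCol Unit u) 0 0).updateRow (Sum.inr ())
          (c • Sum.elim (-v) (0 : Unit → R) + d • Sum.elim (0 : m → R) (1 : Unit → R)) := by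
    ext (i | i) (j | j) <;> simp [updateRow_apply]
  have bordered_det (c : R) (d : R) :
      (fromBlocks M (replicateCol Unit u) (-(c • replicateRow Unit v)) (d • 1)).det =
        c * (fromBlocks M (replicateCol Unit u) (-replicateRow Unit v) 0).det + d * M.det := by
    have h₁ := bordered 1 0
    have h₂ := bordered 0 1
    simp only [one_smul, zero_smul, add_zero, zero_add, neg_zero] at h₁ h₂
    rw [bordered, det_updateRow_add, det_updateRow_smul, det_updateRow_smul, ← h₁, ← h₂]
    simp
  have h := bordered_det t 1
  rw [one_smul, det_fromBlocks_one₂₂, one_mul, mul_comm t] at h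
  rw [← h]
  congr 1
  ext i j
  simp [vecMulVec_apply, Matrix.mul_apply]

/-- The Laplacian quadratic form is half the energy `∑ σ i j (x i - x j) ^ 2`. -/
theorem dotProduct_lap_mulVec {N : ℕ} {σ : Matrix (Fin N) (Fin N) ℝ} (hσ : IsConductance σ)
    (x : Fin N → ℝ) :
    x ⬝ᵥ (lap σ *ᵥ x) = (∑ i, ∑ j, σ i j * (x i - x j) ^ 2) / 2 := by
  obtain ⟨hsymm, -, hdiag⟩ := hσ
  have hrow (i : Fin N) : (lap σ *ᵥ x) i = ∑ j, σ i j * (x i - x j) := by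
    have hentry (j : Fin N) :
        lap σ i j * x j = (if i = j then (∑ k, σ i k) * x i else 0) - σ i j * x j := by
      by_cases h : i = j
      · subst h; simp [lap, hdiag]
      · simp [lap, h]
    simp [mulVec, dotProduct, hentry, mul_sub, Finset.sum_sub_distrib, Finset.sum_mul]
  have hswap : ∑ i, ∑ j, x i * (σ i j * (x i - x j)) =
      ∑ i, ∑ j, x j * (σ i j * (x j - x i)) := by
    rw [Finset.sum_comm]
    simp only [hsymm]
  have hsum : ∑ i, ∑ j, σ i j * (x i - x j) ^ 2 =
      ∑ i, ∑ j, x i * (σ i j * (x i - x j)) + ∑ i, ∑ j, x j * (σ i j * (x j - x i)) := by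
    simp only [← Finset.sum_add_distrib]
    exact Finset.sum_congr rfl fun i _ => Finset.sum_congr rfl fun j _ => by ring
  rw [hsum, ← hswap]
  simp [dotProduct, hrow, Finset.mul_sum]

theorem posSemidef_lap {N : ℕ} {σ : Matrix (Fin N) (Fin N) ℝ} (hσ : IsConductance σ) :
    (lap σ).PosSemidef := by
  refine .of_dotProduct_mulVec_nonneg ?_ fun x => ?_
  · ext i j
    by_cases h : i = j
    · simp [h]
    · simp [lap, h, Ne.symm h, hσ.1 i j]
  · rw [star_trivial, dotProduct_lap_mulVec hσ]
    exact div_nonneg (Finset.sum_nonneg fun i _ => Finset.sum_nonneg fun j _ =>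
      mul_nonneg (hσ.2.1 i j) (sq_nonneg _)) zero_le_two

/-- The matrix `σ` with the conductance of the edge `{k, l}` set to `t`. -/
def setEdge {N : ℕ} (σ : Matrix (Fin N) (Fin N) ℝ) (k l : Fin N) (t : ℝ) :
    Matrix (Fin N) (Fin N) ℝ :=
  Matrix.of fun i j => if (i = k ∧ j = l) ∨ (i = l ∧ j = k) then t else σ i j

theorem IsConductance.setEdge {N : ℕ} {σ : Matrix (Fin N) (Fin N) ℝ} (hσ : IsConductance σ)
    {k l : Fin N} (hkl : k ≠ l) {t : ℝ} (ht : 0 ≤ t) : IsConductance (setEdge σ k l t) := by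
  obtain ⟨hsymm, hnonneg, hdiag⟩ := hσ
  refine ⟨fun i j => ?_, fun i j => ?_, fun i => ?_⟩
  · simp only [_root_.setEdge, of_apply, hsymm i j]
    grind
  · simp only [_root_.setEdge, of_apply]
    split_ifs
    exacts [ht, hnonneg i j]
  · simp only [_root_.setEdge, of_apply, hdiag]
    grind

/-- Changing one edge conductance perturbs the Laplacian by a rank-one matrix. -/
theorem lap_setEdge {N : ℕ} (σ : Matrix (Fin N) (Fin N) ℝ) {k l : Fin N} (hkl : k ≠ l) (t : ℝ) :
    lap (setEdge σ k l t) = lap (setEdge σ k l 0) +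
      t • vecMulVec (Pi.single k 1 - Pi.single l 1) (Pi.single k 1 - Pi.single l 1) := by
  have hentry (i j : Fin N) : setEdge σ k l t i j = setEdge σ k l 0 i j +
      ((if j = l then if i = k then t else 0 else 0) +
        (if j = k then if i = l then t else 0 else 0)) := by
    simp only [setEdge, of_apply]
    grind
  have hrow (i : Fin N) : ∑ j, setEdge σ k l t i j = ∑ j, setEdge σ k l 0 i j +
      ((if i = k then t else 0) + (if i = l then t else 0)) := by
    simp [hentry, Finset.sum_add_distrib]
  ext i j
  simp only [lap, of_apply, Matrix.add_apply, Matrix.smul_apply, vecMulVec_apply, Pi.sub_apply,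
    Pi.single_apply, smul_eq_mul, hrow]
  rw [hentry i j]
  grind

/-- Every principal minor of the Laplacian is an affine function, with nonnegative coefficients,
of each single edge conductance. -/
theorem exists_det_submatrix_lap_setEdge {N : ℕ} {m : Type*} [Fintype m] [DecidableEq m]
    {σ : Matrix (Fin N) (Fin N) ℝ} (hσ : IsConductance σ) {k l : Fin N} (hkl : k ≠ l)
    (f : m → Fin N) :
    ∃ A B : ℝ, 0 ≤ A ∧ 0 ≤ B ∧
      ∀ t : ℝ, 0 ≤ t → ((lap (setEdge σ k l t)).submatrix f f).det = A * t + B := by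
  let u : Fin N → ℝ := Pi.single k 1 - Pi.single l 1
  obtain ⟨A, B, hAB⟩ :
      ∃ A B : ℝ, ∀ t : ℝ, ((lap (setEdge σ k l t)).submatrix f f).det = A * t + B := by
    have h (t : ℝ) : (lap (setEdge σ k l t)).submatrix f f =
        (lap (setEdge σ k l 0)).submatrix f f + t • vecMulVec (u ∘ f) (u ∘ f) := by
      rw [lap_setEdge σ hkl t]
      rfl
    exact ⟨_, _, fun t => (congrArg det (h t)).trans (det_add_smul_vecMulVec _ _ _ t)⟩
  have hnonneg (t : ℝ) (ht : 0 ≤ t) : 0 ≤ A * t + B :=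
    hAB t ▸ ((posSemidef_lap (hσ.setEdge hkl ht)).submatrix f).det_nonneg
  have hB : 0 ≤ B := by simpa using hnonneg 0 le_rfl
  refine ⟨A, B, ?_, hB, fun t _ => hAB t⟩
  by_contra! hA
  have h := hnonneg ((B + 1) / -A) (div_nonneg (by linarith) (by linarith))
  have hcancel : A * ((B + 1) / -A) = -(B + 1) := by
    field_simp [hA.ne]
  linarith

/-- As a function of a single edge conductance `t` (all other entries fixed), both
`det Σ'` and `det Σ''` are linear with nonnegative coefficients; hence the equivalent
conductance is a Möbius function `(A·t + B)/(C·t + D)` of `t`. -/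
theorem det_linear_in_edge {n : ℕ} (σ : Matrix (Fin (n+2)) (Fin (n+2)) ℝ)
    (hσ : IsConductance σ) (k l : Fin (n+2)) (hkl : k ≠ l) :
    ∃ A B C D : ℝ, 0 ≤ A ∧ 0 ≤ B ∧ 0 ≤ C ∧ 0 ≤ D ∧
      ∀ t : ℝ, 0 ≤ t →
        (sigmaP (Matrix.of fun i j =>
          if (i = k ∧ j = l) ∨ (i = l ∧ j = k) then t else σ i j)).det = A * t + B ∧
        (sigmaPP (Matrix.of fun i j =>
          if (i = k ∧ j = l) ∨ (i = l ∧ j = k) then t else σ i j)).det = C * t + D := by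
  obtain ⟨A, B, hA, hB, hAB⟩ :=
    exists_det_submatrix_lap_setEdge hσ hkl (Fin.castSucc (n := n + 1))
  obtain ⟨C, D, hC, hD, hCD⟩ :=
    exists_det_submatrix_lap_setEdge hσ hkl fun i : Fin n => i.succ.castSucc
  exact ⟨A, B, C, D, hA, hB, hC, hD, fun t ht => ⟨hAB t ht, hCD t ht⟩⟩
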